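/- Let 0 ≤ α < 1 and suppose F : ℝ → ℝ satisfies ‖F‖_{X^α(ℝ)} < ∞. Then for every ε > 0 the function G(t₁,t₂) := χ₀(t₁)·χ₀(t₂)·F(max(t₁,t₂)) satisfies ‖G‖_{X^{α−ε}(ℝ²)} ≤ C(α, ε, χ₀)·‖F‖_{X^α(ℝ)}; in particular G belongs to X^{α−ε}(ℝ²). -/

import Mathlib

open MeasureTheory
open scoped RealInnerProductSpace ENNReal NNReal BigOperators

noncomputable section

/-- `e(z) = e^{2πiz}`. -/
def efun (t : ℝ) : ℂ := Complex.exp (2 * (Real.pi : ℂ) * Complex.I * (t : ℂ))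

/-- One-dimensional Fourier transform `F̂(λ) = ∫ F(t) e^{−2πiλt} dt`. -/
def ft1 (F : ℝ → ℂ) (l : ℝ) : ℂ := ∫ t : ℝ, F t * efun (-(l * t))

/-- Two-dimensional Fourier transform. -/
def ft2 (G : ℝ × ℝ → ℂ) (l : ℝ × ℝ) : ℂ :=
  ∫ t : ℝ × ℝ, G t * efun (-(l.1 * t.1 + l.2 * t.2))

/-- Japanese bracket `⟨x⟩ = (1+x²)^{1/2}`. -/
def jap (x : ℝ) : ℝ := Real.sqrt (1 + x ^ 2)

/-- The `X^θ(ℝ)` norm `∫ ⟨λ⟩^θ |F̂(λ)| dλ`. -/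
def Xnorm1 (θ : ℝ) (F : ℝ → ℂ) : ℝ≥0∞ :=
  ∫⁻ l : ℝ, ENNReal.ofReal (jap l ^ θ) * (‖ft1 F l‖₊ : ℝ≥0∞)

/-- The `X^θ(ℝ²)` norm `∫ (max(⟨λ₁⟩,⟨λ₂⟩))^θ |Ĝ(λ₁,λ₂)| dλ₁dλ₂`. -/
def Xnorm2 (θ : ℝ) (G : ℝ × ℝ → ℂ) : ℝ≥0∞ :=
  ∫⁻ l : ℝ × ℝ, ENNReal.ofReal (max (jap l.1) (jap l.2) ^ θ) * (‖ft2 G l‖₊ : ℝ≥0∞)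

section Character

lemma efun_add (s t : ℝ) : efun (s + t) = efun s * efun t := by
  simp only [efun, ← Complex.exp_add]
  congr 1
  push_cast
  ring

lemma efun_zero : efun 0 = 1 := by simp [efun]

@[simp] lemma norm_efun (t : ℝ) : ‖efun t‖ = 1 := by
  have h : efun t = Complex.exp (((2 * Real.pi * t : ℝ) : ℂ) * Complex.I) := by
    simp only [efun]
    congr 1
    push_cast
    ring
  rw [h, Complex.norm_exp_ofReal_mul_I]

lemma efun_mul_neg (t : ℝ) : efun t * efun (-t) = 1 := by
  rw [← efun_add, add_neg_cancel, efun_zero]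

@[fun_prop] lemma continuous_efun : Continuous efun := by
  unfold efun
  fun_prop

lemma hasDerivAt_efun_mul (c t : ℝ) :
    HasDerivAt (fun t : ℝ => efun (c * t)) (2 * (Real.pi : ℂ) * Complex.I * c * efun (c * t)) t := by
  have h1 : HasDerivAt (fun t : ℝ => 2 * (Real.pi : ℂ) * Complex.I * ((c * t : ℝ) : ℂ))
      (2 * (Real.pi : ℂ) * Complex.I * c) t := by
    have := ((hasDerivAt_id t).const_mul c).ofReal_comp.const_mul (2 * (Real.pi : ℂ) * Complex.I)
    simpa using this
  have h2 := h1.cexp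
  simp only [efun]
  convert h2 using 1
  ring

lemma ft1_eq_fourier (F : ℝ → ℂ) : ft1 F = FourierTransform.fourier F := by
  funext l
  rw [Real.fourier_real_eq_integral_exp_smul, ft1]
  refine integral_congr_ae (Filter.Eventually.of_forall fun t => ?_)
  simp only [efun, smul_eq_mul]
  rw [mul_comm]
  congr 2
  push_cast
  ring

lemma continuous_ft1 {F : ℝ → ℂ} (hF : Integrable F) : Continuous (ft1 F) := by
  rw [ft1_eq_fourier]
  exact VectorFourier.fourierIntegral_continuous Real.continuous_fourierChar
    (by exact continuous_inner) hF

/-- Multiplication formula: `∫ F g = ∫ F̂ ǧ` when `ǧ` is integrable. -/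
lemma integral_mul_eq_integral_ft1_mul {F g : ℝ → ℂ} (hF : Integrable F) (hgc : Continuous g)
    (hg : Integrable g) (hg' : Integrable (ft1 g)) :
    ∫ t, F t * g t = ∫ l, ft1 F l * ft1 g (-l) := by
  have hinv : FourierTransform.fourier (fun l => ft1 g (-l)) = g := by
    have h := hgc.fourier_fourierInv_eq hg (by rwa [← ft1_eq_fourier])
    have h2 : FourierTransformInv.fourierInv g = fun l => ft1 g (-l) := by
      funext l
      rw [Real.fourierInv_eq_fourier_neg, ft1_eq_fourier]
    rwa [h2] at h
  have key := VectorFourier.integral_fourierIntegral_smul_eq_flip (μ := (volume : Measure ℝ))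
    (ν := (volume : Measure ℝ)) (L := innerₗ ℝ) (f := F) (g := fun l => ft1 g (-l))
    Real.continuous_fourierChar (by exact continuous_inner) hF hg'.comp_neg
  rw [flip_innerₗ] at key
  rw [ft1_eq_fourier F]
  calc ∫ t, F t * g t = ∫ t, F t * FourierTransform.fourier (fun l => ft1 g (-l)) t := by rw [hinv]
    _ = _ := key.symm

end Character

section Bump

/-- Smooth functions on the line vanishing outside `[-1, 1]`. -/
structure IsBump (f : ℝ → ℂ) : Prop where
  contDiff : ContDiff ℝ (⊤ : ℕ∞) f
  eq_zero : ∀ z, 1 < |z| → f z = 0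

lemma hasCompactSupport_of_eq_zero {f : ℝ → ℂ} (h : ∀ z, 1 < |z| → f z = 0) :
    HasCompactSupport f := by
  refine HasCompactSupport.intro (isCompact_Icc (a := (-1 : ℝ)) (b := 1)) fun x hx => h x ?_
  by_contra! hx'
  exact hx (abs_le.1 hx')

lemma IsBump.isBump_deriv {f : ℝ → ℂ} (hf : IsBump f) : IsBump (deriv f) where
  contDiff := ((contDiff_infty_iff_deriv (𝕜 := ℝ)).1 hf.contDiff).2
  eq_zero z hz := by
    have h : f =ᶠ[nhds z] fun _ => 0 := by
      filter_upwards [(isOpen_lt continuous_const continuous_abs).mem_nhds hz] with y hy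
      exact hf.eq_zero y hy
    rw [h.deriv_eq, deriv_const]

lemma IsBump.hasDerivAt {f : ℝ → ℂ} (hf : IsBump f) (t : ℝ) : HasDerivAt f (deriv f t) t :=
  ((hf.contDiff.differentiable (by simp)) t).hasDerivAt

lemma IsBump.continuous {f : ℝ → ℂ} (hf : IsBump f) : Continuous f := hf.contDiff.continuous

lemma IsBump.exists_norm_le {f : ℝ → ℂ} (hf : IsBump f) : ∃ S, 0 ≤ S ∧ ∀ z, ‖f z‖ ≤ S := by
  obtain ⟨S, hS⟩ := hf.continuous.bounded_above_of_compact_support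
    (hasCompactSupport_of_eq_zero hf.eq_zero)
  exact ⟨S, (norm_nonneg _).trans (hS 0), hS⟩

lemma norm_ft1_le {p : ℝ → ℂ} {B : ℝ} (hp0 : ∀ z, 1 < |z| → p z = 0)
    (hpB : ∀ z, |z| ≤ 1 → ‖p z‖ ≤ B) (l : ℝ) : ‖ft1 p l‖ ≤ 2 * B := by
  have h : ft1 p l = ∫ t in Set.Icc (-1 : ℝ) 1, p t * efun (-(l * t)) := by
    refine (setIntegral_eq_integral_of_forall_compl_eq_zero fun t ht => ?_).symm
    rw [hp0 t, zero_mul]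
    by_contra! ht'
    exact ht (abs_le.1 ht')
  rw [h]
  refine (norm_setIntegral_le_of_norm_le_const (C := B) (by simp) fun t ht => ?_).trans_eq ?_
  · rw [norm_mul, norm_efun, mul_one]
    exact hpB t (abs_le.2 ht)
  · simp only [Measure.real, Real.volume_Icc]
    norm_num
    ring

lemma ft1_deriv {p p' : ℝ → ℂ} (hp : ∀ t, HasDerivAt p (p' t) t) (hp' : Continuous p')
    (hp0 : ∀ z, 1 < |z| → p z = 0) (hp0' : ∀ z, 1 < |z| → p' z = 0) (l : ℝ) :
    ft1 p' l = 2 * Real.pi * Complex.I * l * ft1 p l := by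
  have hd : deriv p = p' := funext fun t => (hp t).deriv
  have hdiff : Differentiable ℝ p := fun t => (hp t).differentiableAt
  have hi : Integrable p :=
    hdiff.continuous.integrable_of_hasCompactSupport (hasCompactSupport_of_eq_zero hp0)
  have hi' : Integrable (deriv p) := by
    rw [hd]
    exact hp'.integrable_of_hasCompactSupport (hasCompactSupport_of_eq_zero hp0')
  have := congrFun (Real.fourier_deriv hi hdiff hi') l
  rw [hd, ← ft1_eq_fourier, ← ft1_eq_fourier] at this
  simpa using this

/-- Quadratic decay of the Fourier transform of a compactly supported `C²` function. -/
lemma one_add_sq_mul_norm_ft1_le {p p' p'' : ℝ → ℂ} {B : ℝ} (hp : ∀ t, HasDerivAt p (p' t) t)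
    (hp' : ∀ t, HasDerivAt p' (p'' t) t) (hp'' : Continuous p'')
    (h0 : ∀ z, 1 < |z| → p z = 0) (h0' : ∀ z, 1 < |z| → p' z = 0)
    (h0'' : ∀ z, 1 < |z| → p'' z = 0) (hB : ∀ z, |z| ≤ 1 → ‖p z‖ ≤ B)
    (hB'' : ∀ z, |z| ≤ 1 → ‖p'' z‖ ≤ B) (l : ℝ) :
    (1 + l ^ 2) * ‖ft1 p l‖ ≤ 4 * B := by
  have hc' : Continuous p' :=
    (show Differentiable ℝ p' from fun t => (hp' t).differentiableAt).continuous
  have h1 := norm_ft1_le h0 hB l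
  have h2 := norm_ft1_le h0'' hB'' l
  rw [ft1_deriv hp' hp'' h0' h0'', ft1_deriv hp hc' h0 h0'] at h2
  simp only [norm_mul, Complex.norm_I, Complex.norm_real, Real.norm_eq_abs, Complex.norm_ofNat,
    abs_of_pos Real.pi_pos, mul_one] at h2
  have h3 : 2 * Real.pi * |l| * (2 * Real.pi * |l| * ‖ft1 p l‖)
      = (4 * Real.pi ^ 2) * (l ^ 2 * ‖ft1 p l‖) := by
    rw [← sq_abs l]
    ring
  rw [h3] at h2
  have h4 : 1 ≤ 4 * Real.pi ^ 2 := by nlinarith [Real.pi_gt_three]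
  have h5 : 0 ≤ l ^ 2 * ‖ft1 p l‖ := by positivity
  nlinarith

/-- The function `t ↦ e(bt) ∫_{-∞}^t f(s) e(-bs) ds`, for `f` vanishing to the left of `-1`. -/
def modPrim (f : ℝ → ℂ) (b t : ℝ) : ℂ :=
  efun (b * t) * ∫ s in (-2 : ℝ)..t, f s * efun (-(b * s))

lemma hasDerivAt_primitive {f : ℝ → ℂ} (hf : Continuous f) (b t : ℝ) :
    HasDerivAt (fun t => ∫ s in (-2 : ℝ)..t, f s * efun (-(b * s))) (f t * efun (-(b * t))) t :=
  intervalIntegral.integral_hasDerivAt_right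
    ((show Continuous fun s => f s * efun (-(b * s)) by fun_prop).intervalIntegrable _ _)
    (Continuous.stronglyMeasurableAtFilter (by fun_prop) _ _) (by fun_prop)

lemma IsBump.mul_modPrim {f : ℝ → ℂ} (hf : IsBump f) (b t : ℝ) :
    2 * Real.pi * Complex.I * b * modPrim f b t = modPrim (deriv f) b t - f t := by
  have hder (x : ℝ) : HasDerivAt (fun x => efun (-(b * x)))
      (2 * Real.pi * Complex.I * (-b) * efun (-(b * x))) x := by
    simpa using hasDerivAt_efun_mul (-b) x
  have hparts := intervalIntegral.integral_mul_deriv_eq_deriv_mul (a := -2) (b := t)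
    (fun x _ => hder x) (fun x _ => hf.hasDerivAt x)
    ((show Continuous fun x : ℝ => 2 * Real.pi * Complex.I * (-b : ℂ) * efun (-(b * x)) by
      fun_prop).intervalIntegrable _ _)
    (hf.isBump_deriv.continuous.intervalIntegrable _ _)
  rw [hf.eq_zero (-2) (by norm_num)] at hparts
  have h1 : ∫ x in (-2 : ℝ)..t, 2 * Real.pi * Complex.I * (-b) * efun (-(b * x)) * f x
      = -(2 * Real.pi * Complex.I * b) * ∫ x in (-2 : ℝ)..t, f x * efun (-(b * x)) := by
    rw [← intervalIntegral.integral_const_mul]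
    congr 1
    funext x
    ring
  have h2 : ∫ x in (-2 : ℝ)..t, efun (-(b * x)) * deriv f x
      = ∫ x in (-2 : ℝ)..t, deriv f x * efun (-(b * x)) := by
    congr 1
    funext x
    ring
  rw [h1, h2] at hparts
  simp only [modPrim]
  linear_combination (-efun (b * t)) * hparts - f t * efun_mul_neg (b * t)

lemma IsBump.hasDerivAt_modPrim {f : ℝ → ℂ} (hf : IsBump f) (b t : ℝ) :
    HasDerivAt (modPrim f b) (modPrim (deriv f) b t) t := by
  have h := (hasDerivAt_efun_mul b t).mul (hasDerivAt_primitive hf.continuous b t)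
  have h2 := hf.mul_modPrim b t
  refine HasDerivAt.congr_deriv (f := modPrim f b) h ?_
  simp only [modPrim] at h2 ⊢
  linear_combination h2 + f t * efun_mul_neg (b * t)

lemma norm_modPrim_le {f : ℝ → ℂ} {S : ℝ} (hS : ∀ z, ‖f z‖ ≤ S) (b : ℝ) {t : ℝ} (ht : |t| ≤ 1) :
    ‖modPrim f b t‖ ≤ 3 * S := by
  have hS0 : 0 ≤ S := (norm_nonneg _).trans (hS 0)
  rw [modPrim, norm_mul, norm_efun, one_mul]
  refine (intervalIntegral.norm_integral_le_of_norm_le_const (C := S) fun x _ => ?_).trans ?_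
  · rw [norm_mul, norm_efun, mul_one]
    exact hS x
  · rw [mul_comm]
    gcongr
    obtain ⟨h1, h2⟩ := abs_le.1 ht
    rw [abs_of_nonneg] <;> linarith

lemma IsBump.exists_norm_modPrim_le {f : ℝ → ℂ} (hf : IsBump f) :
    ∃ S, 0 ≤ S ∧ ∀ b t, |t| ≤ 1 → ‖modPrim f b t‖ ≤ S ∧ |b| * ‖modPrim f b t‖ ≤ S := by
  obtain ⟨S, hS0, hS⟩ := hf.exists_norm_le
  obtain ⟨S', hS0', hS'⟩ := hf.isBump_deriv.exists_norm_le
  refine ⟨3 * S + 3 * S', by positivity, fun b t ht => ?_⟩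
  have h1 := norm_modPrim_le hS b ht
  have h2 := norm_modPrim_le hS' b ht
  refine ⟨by linarith, ?_⟩
  have h3 : ‖2 * Real.pi * Complex.I * b * modPrim f b t‖ ≤ 3 * S' + S := by
    rw [hf.mul_modPrim]
    exact (norm_sub_le _ _).trans (add_le_add h2 (hS t))
  simp only [norm_mul, Complex.norm_I, Complex.norm_real, Real.norm_eq_abs, Complex.norm_ofNat,
    abs_of_pos Real.pi_pos, mul_one] at h3
  have h4 : 0 ≤ |b| * ‖modPrim f b t‖ := by positivity
  nlinarith [Real.pi_gt_three]

/-- The cancellation between `1/a` and `1/b` in the sum of two modulated primitives. -/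
lemma IsBump.exists_norm_modPrim_add_le {f : ℝ → ℂ} (hf : IsBump f) :
    ∃ C, 0 ≤ C ∧ ∀ a b t, |t| ≤ 1 →
      ‖modPrim f a t + modPrim f b t‖ ≤ C * ((1 + |a + b|) / ((1 + |a|) * (1 + |b|))) := by
  obtain ⟨S₀, hS₀, hf₀⟩ := hf.exists_norm_le
  obtain ⟨S, hS, hf₁⟩ := hf.exists_norm_modPrim_le
  obtain ⟨S', hS', hf₂⟩ := hf.isBump_deriv.exists_norm_modPrim_le
  refine ⟨6 * S + S₀ + 2 * S', by positivity, fun a b t ht => ?_⟩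
  obtain ⟨ha, ha'⟩ := hf₁ a t ht
  obtain ⟨hb, hb'⟩ := hf₁ b t ht
  obtain ⟨ga, ga'⟩ := hf₂ a t ht
  obtain ⟨gb, gb'⟩ := hf₂ b t ht
  have eb : |b| ≤ |a + b| + |a| := by
    calc |b| = |(a + b) - a| := by ring_nf
      _ ≤ _ := abs_sub _ _
  have ea : |a| ≤ |a + b| + |b| := by
    calc |a| = |(a + b) - b| := by ring_nf
      _ ≤ _ := abs_sub _ _
  have hprod : |a| * |b| * ‖modPrim f a t + modPrim f b t‖
      ≤ |a + b| * S₀ + |b| * ‖modPrim (deriv f) a t‖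
        + |a| * ‖modPrim (deriv f) b t‖ := by
    have h : (2 * Real.pi * Complex.I) * (a * b * (modPrim f a t + modPrim f b t))
        = -((a + b : ℝ) * f t) + b * modPrim (deriv f) a t
          + a * modPrim (deriv f) b t := by
      push_cast
      linear_combination (b : ℂ) * hf.mul_modPrim a t + (a : ℂ) * hf.mul_modPrim b t
    have h' := congrArg norm h
    have h1 : |a| * |b| * ‖modPrim f a t + modPrim f b t‖
        ≤ ‖(2 * Real.pi * Complex.I) * (a * b * (modPrim f a t + modPrim f b t))‖ := by
      simp only [norm_mul, Complex.norm_I, Complex.norm_real, Real.norm_eq_abs,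
        Complex.norm_ofNat, abs_of_pos Real.pi_pos, mul_one]
      have : 0 ≤ |a| * |b| * ‖modPrim f a t + modPrim f b t‖ := by positivity
      nlinarith [Real.pi_gt_three]
    refine (h1.trans_eq h').trans ((norm_add₃_le).trans ?_)
    simp only [norm_neg, norm_mul, Complex.norm_real, Real.norm_eq_abs]
    gcongr
    exact hf₀ t
  have hadd : ‖modPrim f a t + modPrim f b t‖ ≤ ‖modPrim f a t‖ + ‖modPrim f b t‖ :=
    norm_add_le _ _
  rw [← mul_div_assoc, le_div_iff₀ (by positivity)]
  have k1 : |a| * ‖modPrim f a t + modPrim f b t‖ ≤ 2 * S + |a + b| * S := by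
    calc |a| * ‖modPrim f a t + modPrim f b t‖
        ≤ |a| * ‖modPrim f a t‖ + |a| * ‖modPrim f b t‖ := by
          rw [← mul_add]
          gcongr
      _ ≤ S + (|a + b| + |b|) * ‖modPrim f b t‖ := by gcongr
      _ ≤ S + (|a + b| * S + S) := by
          rw [add_mul]
          gcongr
      _ = _ := by ring
  have k2 : |b| * ‖modPrim f a t + modPrim f b t‖ ≤ 2 * S + |a + b| * S := by
    calc |b| * ‖modPrim f a t + modPrim f b t‖
        ≤ |b| * ‖modPrim f a t‖ + |b| * ‖modPrim f b t‖ := by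
          rw [← mul_add]
          gcongr
      _ ≤ (|a + b| + |a|) * ‖modPrim f a t‖ + S := by gcongr
      _ ≤ (|a + b| * S + S) + S := by
          rw [add_mul]
          gcongr
      _ = _ := by ring
  have k3 : |b| * ‖modPrim (deriv f) a t‖ ≤ |a + b| * S' + S' := by
    calc _ ≤ (|a + b| + |a|) * ‖modPrim (deriv f) a t‖ := by gcongr
      _ ≤ _ := by
          rw [add_mul]
          gcongr
  have k4 : |a| * ‖modPrim (deriv f) b t‖ ≤ |a + b| * S' + S' := by
    calc _ ≤ (|a + b| + |b|) * ‖modPrim (deriv f) b t‖ := by gcongr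
      _ ≤ _ := by
          rw [add_mul]
          gcongr
  have k5 : 0 ≤ |a + b| := abs_nonneg _
  nlinarith [mul_nonneg k5 hS, mul_nonneg k5 hS₀, mul_nonneg k5 hS']

end Bump

section Max

lemma integrable_indicator_mul_prod {φ v : ℝ → ℂ} (hφ : Integrable φ) (hv : Integrable v)
    {D : Set (ℝ × ℝ)} (hDm : MeasurableSet D) :
    Integrable (D.indicator fun p => φ p.1 * v p.2) (volume : Measure (ℝ × ℝ)) :=
  (hφ.mul_prod hv).indicator hDm

lemma integral_indicator_mul_prod {φ v : ℝ → ℂ} (hφ : Integrable φ) (hv : Integrable v)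
    (hv0 : ∀ z, 1 < |z| → v z = 0) {D : Set (ℝ × ℝ)} (hDm : MeasurableSet D)
    (hD : ∀ t, {s | (t, s) ∈ D} =ᵐ[volume] Set.Iic t) :
    ∫ p, D.indicator (fun p => φ p.1 * v p.2) p = ∫ t, φ t * ∫ s in (-2 : ℝ)..t, v s := by
  have hi := integrable_indicator_mul_prod hφ hv hDm
  rw [Measure.volume_eq_prod] at hi ⊢
  rw [integral_prod _ hi]
  refine integral_congr_ae (Filter.Eventually.of_forall fun t => ?_)
  have h1 : (fun s => D.indicator (fun p => φ p.1 * v p.2) (t, s))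
      = {s | (t, s) ∈ D}.indicator fun s => φ t * v s := by
    rfl
  have h0 : ∫ s in Set.Iic (-2 : ℝ), v s = 0 := by
    refine setIntegral_eq_zero_of_forall_eq_zero fun s hs => hv0 s ?_
    rw [Set.mem_Iic] at hs
    rw [lt_abs]
    right
    linarith
  have hm : MeasurableSet {s | (t, s) ∈ D} := measurable_prodMk_left hDm
  simp only
  rw [h1, integral_indicator hm, setIntegral_congr_set (hD t), integral_const_mul,
    ← intervalIntegral.integral_Iic_sub_Iic hv.integrableOn hv.integrableOn, h0, sub_zero]

lemma integral_mul_mul_max {u v : ℝ → ℂ} {F : ℝ → ℂ} (hu : Continuous u) (hv : Continuous v)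
    (hu0 : ∀ z, 1 < |z| → u z = 0) (hv0 : ∀ z, 1 < |z| → v z = 0) (hF : Integrable F) :
    ∫ p : ℝ × ℝ, u p.1 * v p.2 * F (max p.1 p.2)
      = ∫ t, F t * (u t * (∫ s in (-2 : ℝ)..t, v s) + v t * ∫ s in (-2 : ℝ)..t, u s) := by
  have hui : Integrable u := hu.integrable_of_hasCompactSupport (hasCompactSupport_of_eq_zero hu0)
  have hvi : Integrable v := hv.integrable_of_hasCompactSupport (hasCompactSupport_of_eq_zero hv0)
  have hprod {w : ℝ → ℂ} (hw : Continuous w) (hw0 : ∀ z, 1 < |z| → w z = 0) :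
      Integrable fun t => w t * F t := by
    obtain ⟨S, hS⟩ := hw.bounded_above_of_compact_support (hasCompactSupport_of_eq_zero hw0)
    exact hF.bdd_mul hw.aestronglyMeasurable (Filter.Eventually.of_forall hS)
  have hprim {w z : ℝ → ℂ} (hw : Continuous w) (hw0 : ∀ z, 1 < |z| → w z = 0)
      (hz : Continuous z) : Integrable fun t => w t * F t * ∫ s in (-2 : ℝ)..t, z s := by
    have hZ : Continuous fun t => ∫ s in (-2 : ℝ)..t, z s :=
      intervalIntegral.continuous_primitive (fun a b => hz.intervalIntegrable a b) _
    have := hprod (hw.mul hZ) (fun x hx => by simp [hw0 x hx])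
    refine this.congr (Filter.Eventually.of_forall fun t => ?_)
    simp only [Pi.mul_apply]
    ring
  have hD1 : MeasurableSet {p : ℝ × ℝ | p.2 ≤ p.1} := measurableSet_le measurable_snd measurable_fst
  have hD2 : MeasurableSet {p : ℝ × ℝ | p.2 < p.1} := measurableSet_lt measurable_snd measurable_fst
  have hsplit (p : ℝ × ℝ) : u p.1 * v p.2 * F (max p.1 p.2)
      = {p : ℝ × ℝ | p.2 ≤ p.1}.indicator (fun p => (u p.1 * F p.1) * v p.2) p
        + {p : ℝ × ℝ | p.2 < p.1}.indicator (fun p => (v p.1 * F p.1) * u p.2) p.swap := by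
    rcases le_or_gt p.2 p.1 with h | h
    · simp [Set.indicator, h, not_lt.2 h]
      ring
    · simp [Set.indicator, h, not_le.2 h, h.le]
      ring
  have hi2 := integrable_indicator_mul_prod (hprod hv hv0) hui hD2
  have hi2' : Integrable fun p : ℝ × ℝ =>
      {p : ℝ × ℝ | p.2 < p.1}.indicator (fun p => (v p.1 * F p.1) * u p.2) p.swap := by
    rw [Measure.volume_eq_prod] at hi2 ⊢
    exact hi2.swap
  simp_rw [hsplit]
  rw [integral_add (integrable_indicator_mul_prod (hprod hu hu0) hvi hD1) hi2']
  have hswap : ∫ p : ℝ × ℝ,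
      {p : ℝ × ℝ | p.2 < p.1}.indicator (fun p => (v p.1 * F p.1) * u p.2) p.swap
      = ∫ p, {p : ℝ × ℝ | p.2 < p.1}.indicator (fun p => (v p.1 * F p.1) * u p.2) p := by
    rw [Measure.volume_eq_prod]
    exact integral_prod_swap _
  rw [hswap, integral_indicator_mul_prod (hprod hu hu0) hvi hv0 hD1
      (fun t => Filter.EventuallyEq.rfl),
    integral_indicator_mul_prod (hprod hv hv0) hui hu0 hD2 (fun t => Iio_ae_eq_Iic),
    ← integral_add (hprim hu hu0 hv) (hprim hv hv0 hu)]
  refine integral_congr_ae (Filter.Eventually.of_forall fun t => ?_)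
  simp only
  ring

/-- The one-dimensional profile `f (ψ_a + ψ_b)`, where `ψ_b` is the modulated primitive of `f`;
up to translation its Fourier transform is that of `f(t₁) f(t₂) e(μ max(t₁, t₂))`. -/
def maxProfile (f : ℝ → ℂ) (a b t : ℝ) : ℂ := f t * (modPrim f a t + modPrim f b t)

lemma ft2_mul_max {f F : ℝ → ℂ} (hf : IsBump f) (hF : Integrable F) (a b : ℝ) :
    ft2 (fun t => f t.1 * f t.2 * F (max t.1 t.2)) (a, b)
      = ∫ t, F t * (maxProfile f a b t * efun (-((a + b) * t))) := by
  have hc := hf.continuous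
  have h := integral_mul_mul_max (u := fun t => f t * efun (-(a * t)))
    (v := fun t => f t * efun (-(b * t))) (by fun_prop) (by fun_prop)
    (fun z hz => by simp [hf.eq_zero z hz]) (fun z hz => by simp [hf.eq_zero z hz]) hF
  rw [ft2]
  have h0 (t : ℝ × ℝ) : f t.1 * f t.2 * F (max t.1 t.2) * efun (-((a, b).1 * t.1 + (a, b).2 * t.2))
      = f t.1 * efun (-(a * t.1)) * (f t.2 * efun (-(b * t.2))) * F (max t.1 t.2) := by
    simp only [neg_add, efun_add]
    ring
  simp_rw [h0]
  rw [h]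
  refine integral_congr_ae (Filter.Eventually.of_forall fun t => ?_)
  have h1 : efun (-((a + b) * t)) = efun (-(a * t)) * efun (-(b * t)) := by
    rw [← efun_add]
    congr 1
    ring
  simp only [maxProfile, modPrim, h1]
  linear_combination (-F t * f t * efun (-(b * t)) * ∫ s in (-2 : ℝ)..t, f s * efun (-(a * s)))
    * efun_mul_neg (a * t)
    - (F t * f t * efun (-(a * t)) * ∫ s in (-2 : ℝ)..t, f s * efun (-(b * s)))
    * efun_mul_neg (b * t)

lemma IsBump.hasDerivAt_mul_modPrim_add {f g : ℝ → ℂ} (hf : IsBump f) (hg : IsBump g)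
    (a b t : ℝ) :
    HasDerivAt (fun t => f t * (modPrim g a t + modPrim g b t))
      (deriv f t * (modPrim g a t + modPrim g b t)
        + f t * (modPrim (deriv g) a t + modPrim (deriv g) b t)) t :=
  (hf.hasDerivAt t).mul ((hg.hasDerivAt_modPrim a t).add (hg.hasDerivAt_modPrim b t))

lemma IsBump.continuous_modPrim {f : ℝ → ℂ} (hf : IsBump f) (b : ℝ) : Continuous (modPrim f b) :=
  (show Differentiable ℝ (modPrim f b) from
    fun t => (hf.hasDerivAt_modPrim b t).differentiableAt).continuous

lemma IsBump.exists_norm_mul_modPrim_add_le {f g : ℝ → ℂ} (hf : IsBump f) (hg : IsBump g) :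
    ∃ C, 0 ≤ C ∧ ∀ a b t, |t| ≤ 1 → ‖f t * (modPrim g a t + modPrim g b t)‖
      ≤ C * ((1 + |a + b|) / ((1 + |a|) * (1 + |b|))) := by
  obtain ⟨S, hS, hS'⟩ := hf.exists_norm_le
  obtain ⟨C, hC, hC'⟩ := hg.exists_norm_modPrim_add_le
  refine ⟨S * C, by positivity, fun a b t ht => ?_⟩
  rw [norm_mul, mul_assoc]
  exact mul_le_mul (hS' t) (hC' a b t ht) (norm_nonneg _) hS

lemma IsBump.exists_norm_ft1_maxProfile_le {f : ℝ → ℂ} (hf : IsBump f) :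
    ∃ C, 0 ≤ C ∧ ∀ a b l, (1 + l ^ 2) * ‖ft1 (maxProfile f a b) l‖
      ≤ C * ((1 + |a + b|) / ((1 + |a|) * (1 + |b|))) := by
  have hf' := hf.isBump_deriv
  have hf'' := hf'.isBump_deriv
  obtain ⟨C₀, hC₀, h₀⟩ := hf.exists_norm_mul_modPrim_add_le hf
  obtain ⟨C₁, hC₁, h₁⟩ := hf''.exists_norm_mul_modPrim_add_le hf
  obtain ⟨C₂, hC₂, h₂⟩ := hf'.exists_norm_mul_modPrim_add_le hf'
  obtain ⟨C₃, hC₃, h₃⟩ := hf.exists_norm_mul_modPrim_add_le hf''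
  refine ⟨4 * (C₀ + C₁ + 2 * C₂ + C₃), by positivity, fun a b l => ?_⟩
  have hM : 0 ≤ (1 + |a + b|) / ((1 + |a|) * (1 + |b|)) := by positivity
  set M := (1 + |a + b|) / ((1 + |a|) * (1 + |b|))
  rw [mul_assoc]
  refine one_add_sq_mul_norm_ft1_le (fun t => hf.hasDerivAt_mul_modPrim_add hf a b t)
    (fun t => (hf'.hasDerivAt_mul_modPrim_add hf a b t).add
      (hf.hasDerivAt_mul_modPrim_add hf' a b t)) ?_ ?_ ?_ ?_ ?_ ?_ l
  · have := hf.continuous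
    have := hf'.continuous
    have := hf''.continuous
    have := hf.continuous_modPrim
    have := hf'.continuous_modPrim
    have := hf''.continuous_modPrim
    fun_prop
  · intro z hz
    simp [hf.eq_zero z hz]
  · intro z hz
    simp [hf.eq_zero z hz, hf'.eq_zero z hz]
  · intro z hz
    simp [hf.eq_zero z hz, hf'.eq_zero z hz, hf''.eq_zero z hz]
  · intro z hz
    refine (h₀ a b z hz).trans ?_
    gcongr
    linarith
  · intro z hz
    refine (norm_add_le _ _).trans ((add_le_add (norm_add_le _ _) (norm_add_le _ _)).trans ?_)
    linarith [h₁ a b z hz, h₂ a b z hz, h₃ a b z hz, mul_nonneg hC₀ hM]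

lemma ft1_mul_efun (p : ℝ → ℂ) (c l : ℝ) :
    ft1 (fun t => p t * efun (-(c * t))) l = ft1 p (l + c) := by
  refine integral_congr_ae (Filter.Eventually.of_forall fun t => ?_)
  simp only
  rw [mul_assoc, ← efun_add]
  congr 2
  ring

lemma integrable_ft1_of_decay {p : ℝ → ℂ} (hp : Integrable p) {B : ℝ}
    (h : ∀ l, (1 + l ^ 2) * ‖ft1 p l‖ ≤ B) : Integrable (ft1 p) := by
  refine (integrable_inv_one_add_sq.const_mul B).mono'
    (continuous_ft1 hp).aestronglyMeasurable (Filter.Eventually.of_forall fun l => ?_)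
  rw [← div_eq_mul_inv, le_div_iff₀ (by positivity), mul_comm]
  exact h l

lemma IsBump.ft2_mul_max_eq {f F : ℝ → ℂ} (hf : IsBump f) (hF : Integrable F) (a b : ℝ) :
    ft2 (fun t => f t.1 * f t.2 * F (max t.1 t.2)) (a, b)
      = ∫ l, ft1 F l * ft1 (maxProfile f a b) (a + b - l) := by
  obtain ⟨C, -, hC⟩ := hf.exists_norm_ft1_maxProfile_le
  have hpc : Continuous (maxProfile f a b) := by
    have := hf.continuous
    have := hf.continuous_modPrim
    unfold maxProfile
    fun_prop
  have hp0 (z : ℝ) (hz : 1 < |z|) : maxProfile f a b z = 0 := by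
    simp [maxProfile, hf.eq_zero z hz]
  have hpi := hpc.integrable_of_hasCompactSupport (μ := volume) (hasCompactSupport_of_eq_zero hp0)
  have hgc : Continuous fun t => maxProfile f a b t * efun (-((a + b) * t)) := by fun_prop
  rw [ft2_mul_max hf hF, integral_mul_eq_integral_ft1_mul hF hgc]
  · refine integral_congr_ae (Filter.Eventually.of_forall fun l => ?_)
    simp only
    rw [ft1_mul_efun, neg_add_eq_sub]
  · refine hgc.integrable_of_hasCompactSupport (hasCompactSupport_of_eq_zero fun z hz => ?_)
    simp [hp0 z hz]
  · have h : ft1 (fun t => maxProfile f a b t * efun (-((a + b) * t)))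
        = fun l => ft1 (maxProfile f a b) (l + (a + b)) := funext (ft1_mul_efun _ _)
    rw [h]
    exact (integrable_ft1_of_decay hpi (hC a b)).comp_add_right _

end Max

section Weights

lemma jap_pos (x : ℝ) : 0 < jap x := Real.sqrt_pos.2 (by positivity)

lemma jap_sq (x : ℝ) : jap x ^ 2 = 1 + x ^ 2 := Real.sq_sqrt (by positivity)

lemma one_le_jap (x : ℝ) : 1 ≤ jap x := Real.one_le_sqrt.2 (by nlinarith [sq_nonneg x])

lemma abs_le_jap (x : ℝ) : |x| ≤ jap x := Real.abs_le_sqrt (by linarith)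

lemma jap_le_one_add_abs (x : ℝ) : jap x ≤ 1 + |x| := by
  refine Real.sqrt_le_iff.2 ⟨by positivity, ?_⟩
  nlinarith [sq_abs x, abs_nonneg x]

@[fun_prop] lemma continuous_jap : Continuous jap := by
  unfold jap
  fun_prop

lemma jap_add_le (x y : ℝ) : jap (x + y) ≤ jap x + jap y := by
  refine Real.sqrt_le_iff.2 ⟨by linarith [jap_pos x, jap_pos y], ?_⟩
  have h : x * y ≤ jap x * jap y := by
    calc x * y ≤ |x * y| := le_abs_self _
      _ = |x| * |y| := abs_mul x y
      _ ≤ _ := mul_le_mul (abs_le_jap x) (abs_le_jap y) (abs_nonneg _) (jap_pos x).le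
  nlinarith [jap_sq x, jap_sq y]

lemma jap_add_le_mul (x y : ℝ) : jap (x + y) ≤ 2 * (jap x * jap y) := by
  have := jap_add_le x y
  nlinarith [one_le_jap x, one_le_jap y]

lemma max_jap_rpow_div_le {α ε : ℝ} (hα' : α < 1) (hα : 0 ≤ α) (hε : 0 < ε) (a b : ℝ) :
    max (jap a) (jap b) ^ (α - ε) / (jap a * jap b)
      ≤ 2 * jap (a + b) ^ (α - 1) * (jap a ^ (-(1 + ε)) + jap b ^ (-(1 + ε))) := by
  wlog h : jap a ≤ jap b generalizing a b
  · have := this b a (le_of_not_ge h)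
    rwa [max_comm, mul_comm (jap b), add_comm b, add_comm (jap b ^ _)] at this
  have hA := jap_pos a
  have hB := jap_pos b
  have hW := jap_pos (a + b)
  have h1 : jap b ^ (α - 1) ≤ 2 * jap (a + b) ^ (α - 1) := by
    have hle : jap (a + b) / 2 ≤ jap b := by linarith [jap_add_le a b]
    calc jap b ^ (α - 1) ≤ (jap (a + b) / 2) ^ (α - 1) :=
          Real.rpow_le_rpow_of_nonpos (by positivity) hle (by linarith)
      _ = 2 ^ (1 - α) * jap (a + b) ^ (α - 1) := by
          rw [Real.div_rpow hW.le (by norm_num), div_eq_mul_inv, mul_comm,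
            ← Real.rpow_neg (by norm_num), neg_sub]
      _ ≤ 2 ^ (1 : ℝ) * jap (a + b) ^ (α - 1) := by
          gcongr
          · norm_num
          · linarith
      _ = _ := by rw [Real.rpow_one]
  have h2 : jap b ^ (-ε) ≤ jap a ^ (-ε) := Real.rpow_le_rpow_of_nonpos hA h (by linarith)
  calc max (jap a) (jap b) ^ (α - ε) / (jap a * jap b)
      = jap b ^ (α - 1) * (jap b ^ (-ε) * jap a ^ (-1 : ℝ)) := by
        have e1 : jap b ^ (α - ε) = jap b ^ (α - 1) * jap b ^ (-ε) * jap b := by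
          nth_rewrite 4 [← Real.rpow_one (jap b)]
          rw [← Real.rpow_add hB, ← Real.rpow_add hB]
          congr 1
          ring
        rw [max_eq_right h, e1, Real.rpow_neg_one]
        field_simp
    _ ≤ (2 * jap (a + b) ^ (α - 1)) * (jap a ^ (-ε) * jap a ^ (-1 : ℝ)) := by gcongr
    _ = (2 * jap (a + b) ^ (α - 1)) * jap a ^ (-(1 + ε)) := by
        rw [← Real.rpow_add hA]
        congr 2
        ring
    _ ≤ _ := by
        gcongr
        exact le_add_of_nonneg_right (by positivity)

lemma kernel_weight_le {α ε : ℝ} (hα : 0 ≤ α) (hα' : α < 1) (hε : 0 < ε) (a b l : ℝ) :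
    max (jap a) (jap b) ^ (α - ε)
        * ((1 + |a + b|) / ((1 + |a|) * (1 + |b|)) / (1 + (a + b - l) ^ 2))
      ≤ 8 * (jap l ^ α * (jap (a + b - l) ^ (α - 2)
        * (jap a ^ (-(1 + ε)) + jap b ^ (-(1 + ε))))) := by
  have hA := jap_pos a
  have hB := jap_pos b
  have hW := jap_pos (a + b)
  have hX := jap_pos (a + b - l)
  have hL := jap_pos l
  have hmax : 0 < max (jap a) (jap b) := lt_max_of_lt_left hA
  have h1 : (1 + |a + b|) / ((1 + |a|) * (1 + |b|)) ≤ 2 * jap (a + b) / (jap a * jap b) := by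
    gcongr
    · linarith [one_le_jap (a + b), abs_le_jap (a + b)]
    · exact jap_le_one_add_abs a
    · exact jap_le_one_add_abs b
  have h2 : jap (a + b) ^ α ≤ 2 * (jap l ^ α * jap (a + b - l) ^ α) := by
    calc jap (a + b) ^ α ≤ (2 * (jap l * jap (a + b - l))) ^ α := by
          gcongr
          simpa using jap_add_le_mul l (a + b - l)
      _ = 2 ^ α * (jap l ^ α * jap (a + b - l) ^ α) := by
          rw [Real.mul_rpow (by norm_num) (by positivity), Real.mul_rpow hL.le hX.le]
      _ ≤ 2 ^ (1 : ℝ) * (jap l ^ α * jap (a + b - l) ^ α) := by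
          gcongr
          norm_num
      _ = _ := by rw [Real.rpow_one]
  rw [← jap_sq (a + b - l)]
  calc max (jap a) (jap b) ^ (α - ε)
        * ((1 + |a + b|) / ((1 + |a|) * (1 + |b|)) / jap (a + b - l) ^ 2)
      ≤ max (jap a) (jap b) ^ (α - ε)
        * (2 * jap (a + b) / (jap a * jap b) / jap (a + b - l) ^ 2) := by gcongr
    _ = (max (jap a) (jap b) ^ (α - ε) / (jap a * jap b))
        * (2 * jap (a + b) / jap (a + b - l) ^ 2) := by ring
    _ ≤ (2 * jap (a + b) ^ (α - 1) * (jap a ^ (-(1 + ε)) + jap b ^ (-(1 + ε))))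
        * (2 * jap (a + b) / jap (a + b - l) ^ 2) := by
        gcongr
        exact max_jap_rpow_div_le hα' hα hε a b
    _ = 4 * jap (a + b) ^ α * (jap a ^ (-(1 + ε)) + jap b ^ (-(1 + ε)))
        / jap (a + b - l) ^ 2 := by
        rw [Real.rpow_sub_one hW.ne']
        field_simp
        ring
    _ ≤ 4 * (2 * (jap l ^ α * jap (a + b - l) ^ α)) * (jap a ^ (-(1 + ε)) + jap b ^ (-(1 + ε)))
        / jap (a + b - l) ^ 2 := by gcongr
    _ = _ := by
        rw [Real.rpow_sub hX, Real.rpow_two]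
        ring

lemma lintegral_jap_rpow_lt_top {r : ℝ} (hr : r < -1) :
    ∫⁻ x, ENNReal.ofReal (jap x ^ r) < ⊤ := by
  have h := integrable_rpow_neg_one_add_norm_sq (E := ℝ) (μ := volume) (r := -r)
    (by simpa using by linarith)
  have h2 : (fun x : ℝ => (1 + ‖x‖ ^ 2) ^ (- -r / 2)) = fun x => jap x ^ r := by
    funext x
    rw [jap, Real.sqrt_eq_rpow, ← Real.rpow_mul (by positivity), Real.norm_eq_abs, sq_abs]
    congr 1
    ring
  rw [h2] at h
  exact h.lintegral_lt_top

lemma lintegral_shear (k₁ k₂ : ℝ → ℝ≥0∞) (h₁ : Measurable k₁) (h₂ : Measurable k₂) (l : ℝ) :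
    ∫⁻ p : ℝ × ℝ, k₁ (p.1 + p.2 - l) * (k₂ p.1 + k₂ p.2)
      = 2 * ((∫⁻ x, k₁ x) * ∫⁻ x, k₂ x) := by
  have e1 : ∫⁻ p : ℝ × ℝ, k₁ (p.1 + p.2 - l) * k₂ p.1 = (∫⁻ x, k₁ x) * ∫⁻ x, k₂ x := by
    rw [Measure.volume_eq_prod, lintegral_prod _ (by fun_prop)]
    have (x : ℝ) : ∫⁻ y, k₁ (x + y - l) * k₂ x = (∫⁻ y, k₁ y) * k₂ x := by
      rw [lintegral_mul_const _ (by fun_prop)]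
      congr 1
      rw [← lintegral_add_left_eq_self k₁ (x - l)]
      congr 1
      funext y
      congr 1
      ring
    simp_rw [this]
    rw [lintegral_const_mul _ h₂]
  have e2 : ∫⁻ p : ℝ × ℝ, k₁ (p.1 + p.2 - l) * k₂ p.2 = (∫⁻ x, k₁ x) * ∫⁻ x, k₂ x := by
    rw [← e1, Measure.volume_eq_prod,
      ← lintegral_prod_swap (f := fun p : ℝ × ℝ => k₁ (p.1 + p.2 - l) * k₂ p.1)]
    simp only [Prod.fst_swap, Prod.snd_swap, add_comm]
  simp_rw [mul_add]
  rw [lintegral_add_left (by fun_prop), e1, e2, two_mul]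

end Weights

lemma IsBump.exists_Xnorm2_mul_max_le {f : ℝ → ℂ} (hf : IsBump f) {α ε : ℝ} (hα : 0 ≤ α)
    (hα' : α < 1) (hε : 0 < ε) :
    ∃ C : ℝ, 0 < C ∧ ∀ F : ℝ → ℂ, Integrable F →
      Xnorm2 (α - ε) (fun t => f t.1 * f t.2 * F (max t.1 t.2))
        ≤ ENNReal.ofReal C * Xnorm1 α F := by
  obtain ⟨C, hC, hker⟩ := hf.exists_norm_ft1_maxProfile_le
  set k₁ : ℝ → ℝ≥0∞ := fun x => ENNReal.ofReal (jap x ^ (α - 2))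
  set k₂ : ℝ → ℝ≥0∞ := fun x => ENNReal.ofReal (jap x ^ (-(1 + ε)))
  have hk₁ : Measurable k₁ := by fun_prop
  have hk₂ : Measurable k₂ := by fun_prop
  have hI : 2 * ((∫⁻ x, k₁ x) * ∫⁻ x, k₂ x) ≠ ⊤ :=
    ENNReal.mul_ne_top (by simp) (ENNReal.mul_ne_top
      (lintegral_jap_rpow_lt_top (by linarith)).ne (lintegral_jap_rpow_lt_top (by linarith)).ne)
  set I := 2 * ((∫⁻ x, k₁ x) * ∫⁻ x, k₂ x)
  refine ⟨8 * C * I.toReal + 1, by positivity, fun F hF => ?_⟩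
  have hFc := continuous_ft1 hF
  have hpt (p : ℝ × ℝ) : ENNReal.ofReal (max (jap p.1) (jap p.2) ^ (α - ε))
        * (‖ft2 (fun t => f t.1 * f t.2 * F (max t.1 t.2)) p‖₊ : ℝ≥0∞)
      ≤ ∫⁻ l, ENNReal.ofReal (8 * C) * ((ENNReal.ofReal (jap l ^ α) * (‖ft1 F l‖₊ : ℝ≥0∞))
          * (k₁ (p.1 + p.2 - l) * (k₂ p.1 + k₂ p.2))) := by
    obtain ⟨a, b⟩ := p
    have hmax : 0 < max (jap a) (jap b) := lt_max_of_lt_left (jap_pos a)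
    rw [hf.ft2_mul_max_eq hF]
    refine (mul_le_mul_right (enorm_integral_le_lintegral_enorm _) _).trans ?_
    rw [← lintegral_const_mul' _ _ ENNReal.ofReal_ne_top]
    refine lintegral_mono fun l => ?_
    simp only [k₁, k₂]
    rw [← ofReal_norm, ← enorm_eq_nnnorm, ← ofReal_norm,
      ← ENNReal.ofReal_add (Real.rpow_nonneg (jap_pos _).le _) (Real.rpow_nonneg (jap_pos _).le _),
      ← ENNReal.ofReal_mul (by positivity), ← ENNReal.ofReal_mul (Real.rpow_nonneg (jap_pos _).le _),
      ← ENNReal.ofReal_mul (Real.rpow_nonneg (jap_pos _).le _),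
      ← ENNReal.ofReal_mul (mul_nonneg (Real.rpow_nonneg (jap_pos _).le _) (norm_nonneg _)),
      ← ENNReal.ofReal_mul (by positivity)]
    refine ENNReal.ofReal_le_ofReal ?_
    have h1 : ‖ft1 (maxProfile f a b) (a + b - l)‖
        ≤ C * ((1 + |a + b|) / ((1 + |a|) * (1 + |b|)) / (1 + (a + b - l) ^ 2)) := by
      rw [← mul_div_assoc, le_div_iff₀ (by positivity), mul_comm]
      exact hker a b (a + b - l)
    rw [norm_mul]
    calc max (jap a) (jap b) ^ (α - ε) * (‖ft1 F l‖ * ‖ft1 (maxProfile f a b) (a + b - l)‖)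
        ≤ max (jap a) (jap b) ^ (α - ε) * (‖ft1 F l‖
          * (C * ((1 + |a + b|) / ((1 + |a|) * (1 + |b|)) / (1 + (a + b - l) ^ 2)))) := by gcongr
      _ = C * ‖ft1 F l‖ * (max (jap a) (jap b) ^ (α - ε)
          * ((1 + |a + b|) / ((1 + |a|) * (1 + |b|)) / (1 + (a + b - l) ^ 2))) := by ring
      _ ≤ C * ‖ft1 F l‖ * (8 * (jap l ^ α * (jap (a + b - l) ^ (α - 2)
          * (jap a ^ (-(1 + ε)) + jap b ^ (-(1 + ε)))))) :=
          mul_le_mul_of_nonneg_left (kernel_weight_le hα hα' hε a b l) (by positivity)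
      _ = _ := by ring
  calc Xnorm2 (α - ε) (fun t => f t.1 * f t.2 * F (max t.1 t.2))
      ≤ ∫⁻ p : ℝ × ℝ, ∫⁻ l, ENNReal.ofReal (8 * C) * ((ENNReal.ofReal (jap l ^ α)
          * (‖ft1 F l‖₊ : ℝ≥0∞)) * (k₁ (p.1 + p.2 - l) * (k₂ p.1 + k₂ p.2))) :=
        lintegral_mono hpt
    _ = ∫⁻ l, ∫⁻ p : ℝ × ℝ, ENNReal.ofReal (8 * C) * ((ENNReal.ofReal (jap l ^ α)
          * (‖ft1 F l‖₊ : ℝ≥0∞)) * (k₁ (p.1 + p.2 - l) * (k₂ p.1 + k₂ p.2))) := by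
        refine lintegral_lintegral_swap (Measurable.aemeasurable ?_)
        unfold Function.uncurry
        fun_prop
    _ = ∫⁻ l, (ENNReal.ofReal (8 * C) * I) * (ENNReal.ofReal (jap l ^ α)
          * (‖ft1 F l‖₊ : ℝ≥0∞)) := by
        refine lintegral_congr fun l => ?_
        rw [lintegral_const_mul _ (by fun_prop), lintegral_const_mul _ (by fun_prop),
          lintegral_shear k₁ k₂ hk₁ hk₂ l]
        ring
    _ = (ENNReal.ofReal (8 * C) * I) * Xnorm1 α F := lintegral_const_mul _ (by fun_prop)
    _ ≤ _ := by
        gcongr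
        calc ENNReal.ofReal (8 * C) * I = ENNReal.ofReal (8 * C * I.toReal) := by
              rw [ENNReal.ofReal_mul (p := 8 * C) (by positivity), ENNReal.ofReal_toReal hI]
          _ ≤ _ := ENNReal.ofReal_le_ofReal (by linarith)

theorem statement18 (χ₀ : ℝ → ℝ)
    (hχs : ContDiff ℝ (⊤ : ℕ∞) χ₀)
    (hχ1 : ∀ z : ℝ, |z| ≤ 1 / 2 → χ₀ z = 1)
    (hχ0 : ∀ z : ℝ, 1 ≤ |z| → χ₀ z = 0)
    (α : ℝ) (hα : 0 ≤ α) (hα' : α < 1) (ε : ℝ) (hε : 0 < ε) :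
    ∃ C : ℝ, 0 < C ∧
    ∀ F : ℝ → ℝ, Integrable F →
      Xnorm1 α (fun t => (F t : ℂ)) < ⊤ →
      Xnorm2 (α - ε) (fun t => ((χ₀ t.1 * χ₀ t.2 * F (max t.1 t.2) : ℝ) : ℂ))
        ≤ ENNReal.ofReal C * Xnorm1 α (fun t => (F t : ℂ)) := by
  have hf : IsBump fun t => (χ₀ t : ℂ) :=
    ⟨Complex.ofRealCLM.contDiff.comp hχs, fun z hz => by simp [hχ0 z hz.le]⟩
  obtain ⟨C, hC, h⟩ := hf.exists_Xnorm2_mul_max_le hα hα' hε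
  refine ⟨C, hC, fun F hF _ => ?_⟩
  simpa only [Complex.ofReal_mul] using h (fun t => (F t : ℂ)) hF.ofReal
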